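/- Let d ≥ 5 and let W' = (d/(d+2))·((1/(2d))·(P ⊗ P) + |S₁₂⟩⟨S₁₂|) be the state on ℂ^d ⊗ ℂ^d obtained by local filtering of the Werner state, where P = |1⟩⟨1| + |2⟩⟨2| and |S₁₂⟩ = (|12⟩ − |21⟩)/√2. Then there exist Hermitian d × d matrices A, A', B, B', each with all eigenvalues in [−1, 1], such that tr(W' · (A⊗B + A⊗B' + A'⊗B − A'⊗B')) = 2√2·d/(d+2) > 2. Hence W' violates the CHSH inequality. -/

import Mathlib

open Matrix Kronecker

noncomputable section

/-- The projector `P = |1⟩⟨1| + |2⟩⟨2|` onto the span of the first two standard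
basis vectors of `ℂ^d`. -/
def projFirstTwo (d : ℕ) (hd : 2 ≤ d) : Matrix (Fin d) (Fin d) ℂ :=
  Matrix.of fun i j =>
    if i = j ∧ (i = (⟨0, by omega⟩ : Fin d) ∨ i = (⟨1, by omega⟩ : Fin d)) then 1 else 0

/-- The vector `|S₁₂⟩ = (|12⟩ − |21⟩)/√2` in `ℂ^d ⊗ ℂ^d`. -/
def s12Vec (d : ℕ) (hd : 2 ≤ d) : Fin d × Fin d → ℂ := fun p =>
  if p = ((⟨0, by omega⟩ : Fin d), (⟨1, by omega⟩ : Fin d)) then ((Real.sqrt 2 : ℝ) : ℂ)⁻¹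
  else if p = ((⟨1, by omega⟩ : Fin d), (⟨0, by omega⟩ : Fin d)) then -((Real.sqrt 2 : ℝ) : ℂ)⁻¹
  else 0

/-- The rank-one projector `|S₁₂⟩⟨S₁₂|`. -/
def s12Proj (d : ℕ) (hd : 2 ≤ d) : Matrix (Fin d × Fin d) (Fin d × Fin d) ℂ :=
  Matrix.of fun p q => s12Vec d hd p * (starRingEnd ℂ) (s12Vec d hd q)

/-- The state `W' = (d/(d+2))·((1/(2d))·(P⊗P) + |S₁₂⟩⟨S₁₂|)` obtained by local
filtering of the Werner state. -/
def wernerFiltered (d : ℕ) (hd : 2 ≤ d) : Matrix (Fin d × Fin d) (Fin d × Fin d) ℂ :=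
  ((d : ℂ) / ((d : ℂ) + 2)) •
    ((2 * (d : ℂ))⁻¹ • (projFirstTwo d hd ⊗ₖ projFirstTwo d hd) + s12Proj d hd)

/-- A Hermitian matrix with `M³ = M` has all its eigenvalues in `[−1, 1]`. -/
lemma eigenvalues_mem_Icc_of_cube_eq {n : Type*} [Fintype n] [DecidableEq n]
    {M : Matrix n n ℂ} (hM : M.IsHermitian) (h3 : M * M * M = M) (i : n) :
    hM.eigenvalues i ∈ Set.Icc (-1 : ℝ) 1 := by
  set v : n → ℂ := ⇑(hM.eigenvectorBasis i)
  set r := hM.eigenvalues i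
  have hMv : M *ᵥ v = r • v := hM.mulVec_eigenvectorBasis i
  have hv0 : v ≠ 0 := fun h =>
    hM.eigenvectorBasis.orthonormal.ne_zero i (by ext j; exact congrFun h j)
  have hcube : (r * r * r) • v = r • v := by
    rw [← hMv]
    conv_rhs => rw [← h3]
    simp only [← Matrix.mulVec_mulVec, hMv, Matrix.mulVec_smul, smul_smul, mul_assoc]
  have hr3 : r * r * r = r := smul_left_injective ℝ hv0 hcube
  constructor <;> nlinarith [sq_nonneg (r - 1), sq_nonneg (r + 1), sq_nonneg r]

/-- The observable `a σ_z + b σ_x` acting on the span of the basis vectors `i` and `j`. -/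
def planarObservable {n : Type*} [DecidableEq n] (i j : n) (a b : ℝ) : Matrix n n ℂ :=
  Matrix.single i i (a : ℂ) - Matrix.single j j (a : ℂ) +
    (Matrix.single i j (b : ℂ) + Matrix.single j i (b : ℂ))

lemma planarObservable_isHermitian {n : Type*} [DecidableEq n] (i j : n) (a b : ℝ) :
    (planarObservable i j a b).IsHermitian := by
  simp only [Matrix.IsHermitian, planarObservable, Matrix.conjTranspose_add,
    Matrix.conjTranspose_sub, Matrix.conjTranspose_single, Complex.star_def, Complex.conj_ofReal]
  abel

lemma planarObservable_cube {n : Type*} [Fintype n] [DecidableEq n] {i j : n} (hij : i ≠ j)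
    {a b : ℝ} (hab : a ^ 2 + b ^ 2 = 1) :
    planarObservable i j a b * planarObservable i j a b * planarObservable i j a b =
      planarObservable i j a b := by
  have hab' : (a : ℂ) * a + b * b = 1 := by
    have := congrArg Complex.ofReal hab
    push_cast at this
    linear_combination this
  have hsq : planarObservable i j a b * planarObservable i j a b =
      Matrix.single i i 1 + Matrix.single j j 1 := by
    simp only [planarObservable, add_mul, sub_mul, mul_add, mul_sub,
      Matrix.single_mul_single_same, Matrix.single_mul_single_of_ne, ne_eq, hij, hij.symm,
      not_false_eq_true, ← hab', Matrix.single_add, mul_comm (b : ℂ) a]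
    abel
  rw [hsq]
  simp only [planarObservable, add_mul, mul_add, mul_sub,
    Matrix.single_mul_single_same, Matrix.single_mul_single_of_ne, ne_eq, hij, hij.symm,
    not_false_eq_true, one_mul]
  abel

lemma planarObservable_eigenvalues_mem_Icc {n : Type*} [Fintype n] [DecidableEq n] {i j : n}
    (hij : i ≠ j) {a b : ℝ} (hab : a ^ 2 + b ^ 2 = 1) (k : n) :
    (planarObservable_isHermitian i j a b).eigenvalues k ∈ Set.Icc (-1 : ℝ) 1 :=
  eigenvalues_mem_Icc_of_cube_eq _ (planarObservable_cube hij hab) k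

lemma projFirstTwo_eq (d : ℕ) (hd : 2 ≤ d) :
    projFirstTwo d hd = Matrix.single ⟨0, by omega⟩ ⟨0, by omega⟩ 1 +
      Matrix.single ⟨1, by omega⟩ ⟨1, by omega⟩ 1 := by
  ext i j
  simp only [projFirstTwo, Matrix.of_apply, Matrix.add_apply, Matrix.single_apply, Fin.ext_iff]
  split_ifs <;> first | omega | simp

lemma s12Proj_eq (d : ℕ) (hd : 2 ≤ d) :
    s12Proj d hd = (2 : ℂ)⁻¹ •
      (Matrix.single ⟨0, by omega⟩ ⟨0, by omega⟩ 1 ⊗ₖ Matrix.single ⟨1, by omega⟩ ⟨1, by omega⟩ 1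
      - Matrix.single ⟨0, by omega⟩ ⟨1, by omega⟩ 1 ⊗ₖ Matrix.single ⟨1, by omega⟩ ⟨0, by omega⟩ 1
      - Matrix.single ⟨1, by omega⟩ ⟨0, by omega⟩ 1 ⊗ₖ Matrix.single ⟨0, by omega⟩ ⟨1, by omega⟩ 1
      + Matrix.single ⟨1, by omega⟩ ⟨1, by omega⟩ 1 ⊗ₖ
        Matrix.single ⟨0, by omega⟩ ⟨0, by omega⟩ 1) := by
  have h2 : ((Real.sqrt 2 : ℝ) : ℂ)⁻¹ * ((Real.sqrt 2 : ℝ) : ℂ)⁻¹ = (2 : ℂ)⁻¹ := by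
    rw [← mul_inv, ← Complex.ofReal_mul, Real.mul_self_sqrt (by norm_num)]
    norm_num
  have hvec : s12Vec d hd = ((Real.sqrt 2 : ℝ) : ℂ)⁻¹ •
      (Pi.single (⟨0, by omega⟩, ⟨1, by omega⟩) 1 - Pi.single (⟨1, by omega⟩, ⟨0, by omega⟩) 1) := by
    funext p
    by_cases h : p = (⟨0, by omega⟩, ⟨1, by omega⟩)
    · simp [s12Vec, h]
    · simp only [s12Vec, h, if_false, Pi.smul_apply, Pi.sub_apply, Pi.single_apply]
      split_ifs <;> simp
  have hproj : s12Proj d hd = Matrix.vecMulVec (s12Vec d hd) (star (s12Vec d hd)) := rfl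
  rw [hproj, hvec]
  simp only [star_smul, star_sub, Pi.star_single, Matrix.smul_vecMulVec, Matrix.vecMulVec_smul,
    Matrix.sub_vecMulVec, Matrix.vecMulVec_sub, Matrix.single_kronecker_single, star_one,
    Complex.star_def, map_inv₀, Complex.conj_ofReal, ← Matrix.single_eq_single_vecMulVec_single,
    mul_one]
  rw [← smul_sub, smul_smul, h2]
  congr 1
  abel

/-- The correlation `tr(W'·(X⊗Y))` in terms of the upper left `2 × 2` blocks of `X` and `Y`. -/
lemma trace_wernerFiltered_mul_kronecker (d : ℕ) (hd : 2 ≤ d) (X Y : Matrix (Fin d) (Fin d) ℂ)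
    (o l : Fin d) (ho : o = ⟨0, by omega⟩) (hl : l = ⟨1, by omega⟩) :
    Matrix.trace (wernerFiltered d hd * (X ⊗ₖ Y)) =
      (d : ℂ) / ((d : ℂ) + 2) * ((2 * (d : ℂ))⁻¹ * ((X o o + X l l) * (Y o o + Y l l)) +
        2⁻¹ * (X o o * Y l l - X l o * Y o l - X o l * Y l o + X l l * Y o o)) := by
  rw [wernerFiltered, projFirstTwo_eq, s12Proj_eq, ← ho, ← hl]
  simp only [smul_mul_assoc, add_mul, sub_mul, ← Matrix.mul_kronecker_mul, Matrix.trace_smul,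
    Matrix.trace_add, Matrix.trace_sub, Matrix.trace_kronecker, Matrix.trace_single_mul,
    smul_eq_mul, one_mul]

/-- For `d ≥ 5`, the filtered Werner state `W'` violates the CHSH inequality:
there are Hermitian observables `A, A', B, B'` with eigenvalues in `[−1,1]` such
that `tr(W'·(A⊗B + A⊗B' + A'⊗B − A'⊗B')) = 2√2·d/(d+2) > 2`. -/
theorem filtered_werner_chsh_violation (d : ℕ) (hd : 5 ≤ d) :
    ∃ (A A' B B' : Matrix (Fin d) (Fin d) ℂ)
      (hA : A.IsHermitian) (hA' : A'.IsHermitian)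
      (hB : B.IsHermitian) (hB' : B'.IsHermitian),
      (∀ i, hA.eigenvalues i ∈ Set.Icc (-1 : ℝ) 1) ∧
      (∀ i, hA'.eigenvalues i ∈ Set.Icc (-1 : ℝ) 1) ∧
      (∀ i, hB.eigenvalues i ∈ Set.Icc (-1 : ℝ) 1) ∧
      (∀ i, hB'.eigenvalues i ∈ Set.Icc (-1 : ℝ) 1) ∧
      Matrix.trace (wernerFiltered d (by omega) *
          (A ⊗ₖ B + A ⊗ₖ B' + A' ⊗ₖ B - A' ⊗ₖ B')) =
        ((2 * Real.sqrt 2 * d / (d + 2) : ℝ) : ℂ) ∧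
      (2 : ℝ) < 2 * Real.sqrt 2 * d / (d + 2) := by
  have hs2 : Real.sqrt 2 * Real.sqrt 2 = 2 := Real.mul_self_sqrt (by norm_num)
  have hd' : (5 : ℝ) ≤ d := by exact_mod_cast hd
  obtain ⟨o, ho⟩ : ∃ o : Fin d, o = ⟨0, by omega⟩ := ⟨_, rfl⟩
  obtain ⟨l, hl⟩ : ∃ l : Fin d, l = ⟨1, by omega⟩ := ⟨_, rfl⟩
  have hol : o ≠ l := by simp [ho, hl]
  have hunit : (Real.sqrt 2 / 2) ^ 2 + (Real.sqrt 2 / 2) ^ 2 = 1 := by nlinarith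
  refine ⟨planarObservable o l 1 0, planarObservable o l 0 1,
    planarObservable o l (-(Real.sqrt 2 / 2)) (-(Real.sqrt 2 / 2)),
    planarObservable o l (-(Real.sqrt 2 / 2)) (Real.sqrt 2 / 2),
    planarObservable_isHermitian _ _ _ _, planarObservable_isHermitian _ _ _ _,
    planarObservable_isHermitian _ _ _ _, planarObservable_isHermitian _ _ _ _,
    planarObservable_eigenvalues_mem_Icc hol (by norm_num),
    planarObservable_eigenvalues_mem_Icc hol (by norm_num),
    planarObservable_eigenvalues_mem_Icc hol (by rw [neg_sq, hunit]),
    planarObservable_eigenvalues_mem_Icc hol (by rw [neg_sq, hunit]), ?_, ?_⟩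
  · simp only [mul_add, mul_sub, Matrix.trace_add, Matrix.trace_sub,
      trace_wernerFiltered_mul_kronecker d _ _ _ o l ho hl]
    simp [planarObservable, hol, hol.symm]
    ring
  · rw [lt_div_iff₀ (by positivity)]
    have : (1.41 : ℝ) < Real.sqrt 2 := Real.lt_sqrt_of_sq_lt (by norm_num)
    nlinarith

end
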